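/- Let R₊ := {(x₁,x₂,x₃) ∈ ℚ³ : x₁ + x₂ + x₃ ≥ 1} and R₋ := {(x₁,x₂,x₃) ∈ ℚ³ : x₁ + x₂ + x₃ ≤ −1}. There is no totally symmetric operation t : ℚ³ → ℚ that preserves both R₊ and R₋. -/

import Mathlib

/-- `R₊ := {(x₁,x₂,x₃) ∈ ℚ³ : x₁ + x₂ + x₃ ≥ 1}`. -/
def Rplus : Set (Fin 3 → ℚ) := { x | 1 ≤ x 0 + x 1 + x 2 }

/-- `R₋ := {(x₁,x₂,x₃) ∈ ℚ³ : x₁ + x₂ + x₃ ≤ −1}`. -/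
def Rminus : Set (Fin 3 → ℚ) := { x | x 0 + x 1 + x 2 ≤ -1 }

/-- An operation `t : ℚ³ → ℚ` is totally symmetric if its value depends only
on the set of its arguments. -/
def TotallySymmetric (t : (Fin 3 → ℚ) → ℚ) : Prop :=
  ∀ x y : Fin 3 → ℚ, Set.range x = Set.range y → t x = t y

/-- `t : ℚ³ → ℚ` preserves `R ⊆ ℚ³` if applying `t` coordinatewise to any
three triples in `R` yields a triple in `R`. -/
def Preserves (t : (Fin 3 → ℚ) → ℚ) (R : Set (Fin 3 → ℚ)) : Prop :=
  ∀ a ∈ R, ∀ b ∈ R, ∀ c ∈ R, (fun i => t ![a i, b i, c i]) ∈ R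

/-- There is no totally symmetric operation `t : ℚ³ → ℚ` preserving both
`R₊` and `R₋`. -/
theorem no_totally_symmetric_polymorphism :
    ¬ ∃ t : (Fin 3 → ℚ) → ℚ,
        TotallySymmetric t ∧ Preserves t Rplus ∧ Preserves t Rminus := by
  rintro ⟨t, ht, hp, hm⟩
  have P : ∀ a b c : ℚ, 1 ≤ a + b + c → ![a, b, c] ∈ Rplus := fun _ _ _ h => h
  have M : ∀ a b c : ℚ, a + b + c ≤ -1 → ![a, b, c] ∈ Rminus := fun _ _ _ h => h
  have h1 := hp _ (P (-1) 1 1 (by norm_num)) _ (P 1 (-1) 1 (by norm_num))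
    _ (P 1 1 (-1) (by norm_num))
  have h2 := hm _ (M 1 (-1) (-1) (by norm_num)) _ (M (-1) 1 (-1) (by norm_num))
    _ (M (-1) (-1) 1 (by norm_num))
  have r : ∀ a b c : ℚ, Set.range ![a, b, c] = {a, b, c} := by
    intro a b c
    ext x
    simp [eq_comm]
    tauto
  have e1 : t ![1, -1, 1] = t ![-1, 1, 1] := ht _ _ (by rw [r, r]; ext x; simp <;> tauto)
  have e2 : t ![1, 1, -1] = t ![-1, 1, 1] := ht _ _ (by rw [r, r]; ext x; simp <;> tauto)
  have e3 : t ![1, -1, -1] = t ![-1, 1, 1] := ht _ _ (by rw [r, r]; ext x; simp <;> tauto)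
  have e4 : t ![-1, 1, -1] = t ![-1, 1, 1] := ht _ _ (by rw [r, r]; ext x; simp <;> tauto)
  have e5 : t ![-1, -1, 1] = t ![-1, 1, 1] := ht _ _ (by rw [r, r]; ext x; simp)
  change 1 ≤ t ![-1, 1, 1] + t ![1, -1, 1] + t ![1, 1, -1] at h1
  change t ![1, -1, -1] + t ![-1, 1, -1] + t ![-1, -1, 1] ≤ -1 at h2
  linarith
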